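/- arXiv:1511.09378 — 3 statements merged into one kernel-verified Lean document; each statement's English description precedes it below -/
import Mathlib

section
/- Let A be a set, H a group which is generated (as a group) by the image of a map ε_H : A → H, and M an inverse monoid which is quasi-A-generated with respect to a map ε_M : A → M. Let ψ : H → M be a dual premorphism such that ψ(ε_H(a)) = ε_M(a) for all a ∈ A (ψ is canonical). Then ψ has property (1): for every m ∈ M there exists h ∈ H with m ≤ ψ(h). -/
namespace FInv

variable {M : Type*}

/-- The natural partial order on an inverse monoid: `a ≤ b` iff `a = e * b`
for some idempotent `e`. -/
def natLe [Monoid M] (a b : M) : Prop := ∃ e : M, e * e = e ∧ a = e * b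

/-- `inv` is an inversion map making the monoid an inverse monoid:
every element has a unique generalized inverse, given by `inv`. -/
def IsInverseMonoid [Monoid M] (inv : M → M) : Prop :=
  (∀ a : M, a * inv a * a = a) ∧ (∀ a : M, inv a * a * inv a = inv a) ∧
    (∀ a b : M, a * b * a = a → b * a * b = b → b = inv a)

/-- `m` is maximal with respect to the natural partial order. -/
def IsMaximal [Monoid M] (m : M) : Prop := ∀ n : M, natLe m n → n = m

/-- `M` is finite-above: the set of elements above any element is finite. -/
def FiniteAbove (M : Type*) [Monoid M] : Prop := ∀ m : M, {n : M | natLe m n}.Finite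

/-- The least group congruence `σ`: `a σ b` iff some element lies below both. -/
def sigmaRel [Monoid M] (a b : M) : Prop := ∃ c : M, natLe c a ∧ natLe c b

/-- `M` is E-unitary: every element above an idempotent is idempotent. -/
def EUnitary (M : Type*) [Monoid M] : Prop :=
  ∀ e a : M, e * e = e → natLe e a → a * a = a

/-- The set of idempotents of `M`. -/
def idems (M : Type*) [Monoid M] : Set M := {e : M | e * e = e}

/-- The submonoid generated by `S` together with the inverses of elements of `S`,
i.e. the closure of `S` under multiplication and inversion. -/
def invClosure [Monoid M] (inv : M → M) (S : Set M) : Submonoid M :=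
  Submonoid.closure (S ∪ inv '' S)

/-- `M` is quasi-generated by `S`: `M` is generated, under multiplication and
inversion, by `S` together with the idempotents of `M`. -/
def QuasiGen [Monoid M] (inv : M → M) (S : Set M) : Prop :=
  invClosure inv (S ∪ idems M) = ⊤

/-- A homomorphism is idempotent-separating if it is injective on idempotents. -/
def IdempotentSeparating [Monoid M] {N : Type*} [Monoid N] (φ : M →* N) : Prop :=
  ∀ e f : M, e * e = e → f * f = f → φ e = φ f → e = f

/-- A dual premorphism from a group `H` to an inverse monoid `M` (with inversion `inv`). -/
def IsDualPremorphism {H : Type*} [Group H] [Monoid M] (inv : M → M) (ψ : H → M) : Prop :=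
  ψ 1 = 1 ∧ (∀ h : H, ψ h⁻¹ = inv (ψ h)) ∧ ∀ g h : H, natLe (ψ g * ψ h) (ψ (g * h))

/-- Property (1): every element of `M` lies below some `ψ h`. -/
def Property1 {H : Type*} [Group H] [Monoid M] (ψ : H → M) : Prop :=
  ∀ m : M, ∃ h : H, natLe m (ψ h)

end FInv

open FInv

theorem idem_mul_aux {M : Type*} [Monoid M] {inv : M → M} (hM : IsInverseMonoid inv)
    {e f : M} (he : e * e = e) (hf : f * f = f) : (e * f) * (e * f) = e * f := by
  obtain ⟨h1, h2, h3⟩ := hM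
  have hee : ∀ z, e * (e * z) = e * z := fun z => by rw [← mul_assoc, he]
  have hff : ∀ z, f * (f * z) = f * z := fun z => by rw [← mul_assoc, hf]
  have a1 := h1 (e * f)
  have a2 := h2 (e * f)
  generalize hx : inv (e * f) = x at a1 a2
  simp only [mul_assoc] at a1 a2
  have ha2z : ∀ z, x * (e * (f * (x * z))) = x * z := fun z => by
    have := congrArg (· * z) a2
    simpa only [mul_assoc] using this
  have hy : f * x * e = x := by
    rw [← hx]
    apply h3
    · rw [hx]; simp only [mul_assoc, hee, hff, a1]
    · rw [hx]; simp only [mul_assoc, hee, hff, ha2z]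
  have hxx : x * x = x := by
    have : (f * x * e) * (f * x * e) = f * x * e := by
      simp only [mul_assoc, ha2z]
    rwa [hy] at this
  have i1 : x = inv x := h3 x x (by rw [hxx, hxx]) (by rw [hxx, hxx])
  have i2 : e * f = inv x := h3 x (e * f) (by simpa only [mul_assoc] using a2)
    (by simpa only [mul_assoc] using a1)
  rw [i2, ← i1, hxx]

theorem idem_comm_aux {M : Type*} [Monoid M] {inv : M → M} (hM : IsInverseMonoid inv)
    {e f : M} (he : e * e = e) (hf : f * f = f) : e * f = f * e := by
  have p := idem_mul_aux hM he hf
  have q := idem_mul_aux hM hf he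
  obtain ⟨h1, h2, h3⟩ := hM
  have hee : ∀ z, e * (e * z) = e * z := fun z => by rw [← mul_assoc, he]
  have hff : ∀ z, f * (f * z) = f * z := fun z => by rw [← mul_assoc, hf]
  have i1 : e * f = inv (e * f) := h3 _ _ (by rw [p, p]) (by rw [p, p])
  have i2 : f * e = inv (e * f) := by
    simp only [mul_assoc] at p q
    apply h3
    · simp only [mul_assoc, hee, hff, p]
    · simp only [mul_assoc, hee, hff, q]
  rw [i2, ← i1]

theorem natLe_mul_aux {M : Type*} [Monoid M] {inv : M → M} (hM : IsInverseMonoid inv)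
    {m n a b c : M} (hm : natLe m a) (hn : natLe n b) (hc : natLe (a * b) c) :
    natLe (m * n) c := by
  obtain ⟨e, he, rfl⟩ := hm
  obtain ⟨f, hf, rfl⟩ := hn
  obtain ⟨k, hk, hkc⟩ := hc
  have ha : a * inv a * a = a := hM.1 a
  have hi : (inv a * a) * (inv a * a) = inv a * a := by
    rw [← mul_assoc, hM.2.1 a]
  have hcm := idem_comm_aux hM hi hf
  have haf : a * f * inv a * a = a * f := by
    calc a * f * inv a * a = a * (f * (inv a * a)) := by simp only [mul_assoc]
      _ = a * inv a * a * f := by rw [← hcm]; simp only [mul_assoc]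
      _ = a * f := by rw [ha]
  have hg : (a * f * inv a) * (a * f * inv a) = a * f * inv a := by
    calc (a * f * inv a) * (a * f * inv a) = (a * f * inv a * a) * f * inv a := by
          simp only [mul_assoc]
      _ = a * (f * f) * inv a := by rw [haf]; simp only [mul_assoc]
      _ = a * f * inv a := by rw [hf]
  refine ⟨e * (a * f * inv a) * k, idem_mul_aux hM (idem_mul_aux hM he hg) hk, ?_⟩
  calc e * a * (f * b) = e * (a * f) * b := by simp only [mul_assoc]
    _ = e * (a * f * inv a * a) * b := by rw [haf]
    _ = e * (a * f * inv a) * (a * b) := by simp only [mul_assoc]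
    _ = _ := by rw [hkc]; simp only [mul_assoc]

/-- A canonical dual premorphism from an `A`-generated group to a quasi-`A`-generated
inverse monoid has property (1). -/
theorem stmt7 {A H M : Type*} [Group H] [Monoid M]
    (inv : M → M) (hM : IsInverseMonoid inv)
    (εH : A → H) (hHgen : Subgroup.closure (Set.range εH) = ⊤)
    (εM : A → M) (hMgen : QuasiGen inv (Set.range εM))
    (ψ : H → M) (hψ : IsDualPremorphism inv ψ)
    (hcan : ∀ a : A, ψ (εH a) = εM a) :
    Property1 ψ := by
  have hrefl : ∀ x : M, natLe x x := fun x => ⟨1, one_mul 1, (one_mul x).symm⟩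
  obtain ⟨hψ1, hψi, hψm⟩ := hψ
  have hid : ∀ e : M, e * e = e → natLe e (ψ 1) := fun e he =>
    ⟨e, he, by rw [hψ1, mul_one]⟩
  intro m
  have hm : m ∈ invClosure inv (Set.range εM ∪ idems M) := by
    rw [show invClosure inv (Set.range εM ∪ idems M) = ⊤ from hMgen]
    trivial
  unfold invClosure at hm
  induction hm using Submonoid.closure_induction with
  | mem x hx =>
    rcases hx with (⟨a, rfl⟩ | hx) | ⟨y, ⟨a, rfl⟩ | hy, rfl⟩
    · exact ⟨εH a, by rw [hcan]; exact hrefl _⟩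
    · exact ⟨1, hid _ hx⟩
    · exact ⟨(εH a)⁻¹, by rw [hψi, hcan]; exact hrefl _⟩
    · have hyy : y * y = y := hy
      have : y = inv y := hM.2.2 y y (by rw [hyy, hyy]) (by rw [hyy, hyy])
      exact ⟨1, hid _ (by rw [← this]; exact hyy)⟩
  | one => exact ⟨1, hid 1 (one_mul 1)⟩
  | mul x y _ _ hx hy =>
    obtain ⟨g, hg⟩ := hx
    obtain ⟨h, hh⟩ := hy
    exact ⟨g * h, natLe_mul_aux hM hg hh (hψm g h)⟩
end

section
/- Let M be a finite-above E-unitary inverse monoid having no F-inverse cover via Abelian groups, i.e., there do not exist a group H and a dual premorphism ψ : H → M with property (1) such that any two elements of {k ∈ H : ψ(k) is idempotent} commute. Then: (i) there exist x, y ∈ M such that x, y, 1 are pairwise non-σ-related (so M/σ has at least two elements distinct from the identity); and (ii) there exist two distinct maximal elements m₁ ≠ m₂ of M with m₁ σ m₂ (some σ-class contains at least two maximal elements). -/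
open FInv

namespace FInv

/-- There is a dual premorphism `ψ : H → M` with property (1) whose "kernel"
`{k : H | ψ k is idempotent}` is commutative. -/
def AbelianKernelCover (M : Type*) [Monoid M] (invM : M → M)
    (H : Type*) [Group H] : Prop :=
  ∃ ψ : H → M, IsDualPremorphism invM ψ ∧ Property1 ψ ∧
    ∀ k₁ k₂ : H, ψ k₁ * ψ k₁ = ψ k₁ → ψ k₂ * ψ k₂ = ψ k₂ → k₁ * k₂ = k₂ * k₁

end FInv

namespace FInv

section Basic
variable {M : Type*} [Monoid M] {inv : M → M}

theorem inv_eq' (hM : IsInverseMonoid inv) {a b : M} (h1 : a * b * a = a) (h2 : b * a * b = b) :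
    inv a = b := (hM.2.2 a b h1 h2).symm

theorem inv_inv' (hM : IsInverseMonoid inv) (a : M) : inv (inv a) = a :=
  inv_eq' hM (hM.2.1 a) (hM.1 a)

theorem inv_idem (hM : IsInverseMonoid inv) {e : M} (he : e * e = e) : inv e = e :=
  inv_eq' hM (by rw [he, he]) (by rw [he, he])

theorem idem_mul (hM : IsInverseMonoid inv) {e f : M} (he : e * e = e) (hf : f * f = f) :
    (e * f) * (e * f) = e * f := by
  have he' : ∀ z, e * (e * z) = e * z := fun z => by rw [← mul_assoc, he]
  have hf' : ∀ z, f * (f * z) = f * z := fun z => by rw [← mul_assoc, hf]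
  obtain ⟨x, hx⟩ : ∃ x, x = inv (e * f) := ⟨_, rfl⟩
  have h1 : (e * f) * x * (e * f) = e * f := by rw [hx]; exact hM.1 _
  have h2 : x * (e * f) * x = x := by rw [hx]; exact hM.2.1 _
  have h2' : ∀ z, x * (e * (f * (x * z))) = x * z := fun z => by
    conv_rhs => rw [← h2]
    simp only [mul_assoc]
  have h3 : f * x * e = x := by
    rw [hx]; symm
    apply inv_eq' hM
    · rw [← hx]
      simp only [mul_assoc, he', hf'] at h1 ⊢
      exact h1
    · rw [← hx]
      simp only [mul_assoc, he', hf', h2']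
  have h4 : x * x = x := by
    calc x * x = (f * x * e) * (f * x * e) := by rw [h3]
      _ = f * x * e := by simp only [mul_assoc, h2']
      _ = x := h3
  have h5 : inv x = e * f := inv_eq' hM h2 h1
  rw [inv_idem hM h4] at h5
  rw [← h5, h4]

theorem idem_comm (hM : IsInverseMonoid inv) {e f : M} (he : e * e = e) (hf : f * f = f) :
    e * f = f * e := by
  have h1 := idem_mul hM he hf
  have h2 := idem_mul hM hf he
  have he' : ∀ z, e * (e * z) = e * z := fun z => by rw [← mul_assoc, he]
  have hf' : ∀ z, f * (f * z) = f * z := fun z => by rw [← mul_assoc, hf]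
  rw [← inv_idem hM h1]
  apply inv_eq' hM
  · simp only [mul_assoc, he', hf'] at h1 ⊢
    exact h1
  · simp only [mul_assoc, he', hf'] at h2 ⊢
    exact h2

theorem idem_r (hM : IsInverseMonoid inv) (a : M) : (a * inv a) * (a * inv a) = a * inv a := by
  rw [← mul_assoc, hM.1]

theorem idem_l (hM : IsInverseMonoid inv) (a : M) : (inv a * a) * (inv a * a) = inv a * a := by
  rw [← mul_assoc, hM.2.1]

theorem inv_mul' (hM : IsInverseMonoid inv) (a b : M) : inv (a * b) = inv b * inv a := by
  have hc := idem_comm hM (idem_r hM b) (idem_l hM a)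
  apply inv_eq' hM
  · calc a * b * (inv b * inv a) * (a * b) = a * ((b * inv b) * (inv a * a)) * b := by
          simp only [mul_assoc]
      _ = (a * inv a * a) * (b * inv b * b) := by rw [hc]; simp only [mul_assoc]
      _ = a * b := by rw [hM.1, hM.1]
  · calc inv b * inv a * (a * b) * (inv b * inv a)
        = inv b * ((inv a * a) * (b * inv b)) * inv a := by simp only [mul_assoc]
      _ = (inv b * b * inv b) * (inv a * a * inv a) := by rw [← hc]; simp only [mul_assoc]
      _ = inv b * inv a := by rw [hM.2.1, hM.2.1]

theorem conj_idem (hM : IsInverseMonoid inv) (c : M) {e : M} (he : e * e = e) :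
    (c * e * inv c) * (c * e * inv c) = c * e * inv c ∧ c * e = (c * e * inv c) * c := by
  have hc := idem_comm hM he (idem_l hM c)
  have h2 : c * e = (c * e * inv c) * c := by
    calc c * e = (c * inv c * c) * e := by rw [hM.1]
      _ = c * ((inv c * c) * e) := by simp only [mul_assoc]
      _ = (c * e * inv c) * c := by rw [← hc]; simp only [mul_assoc]
  refine ⟨?_, h2⟩
  calc (c * e * inv c) * (c * e * inv c) = ((c * e * inv c) * c) * e * inv c := by
        simp only [mul_assoc]
    _ = c * e * inv c := by rw [← h2, mul_assoc c e e, he]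

theorem natLe_refl (a : M) : natLe a a := ⟨1, by simp, by simp⟩

theorem natLe_trans (hM : IsInverseMonoid inv) {a b c : M} (h1 : natLe a b) (h2 : natLe b c) :
    natLe a c := by
  obtain ⟨e, he, rfl⟩ := h1
  obtain ⟨f, hf, rfl⟩ := h2
  exact ⟨e * f, idem_mul hM he hf, by rw [mul_assoc]⟩

theorem natLe_right {a b : M} (c : M) (h : natLe a b) : natLe (a * c) (b * c) := by
  obtain ⟨e, he, rfl⟩ := h
  exact ⟨e, he, by rw [mul_assoc]⟩

theorem natLe_of_mul_idem (hM : IsInverseMonoid inv) (c : M) {e : M} (he : e * e = e) :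
    natLe (c * e) c := ⟨_, (conj_idem hM c he).1, (conj_idem hM c he).2⟩

theorem natLe_left (hM : IsInverseMonoid inv) {a b : M} (c : M) (h : natLe a b) :
    natLe (c * a) (c * b) := by
  obtain ⟨e, he, rfl⟩ := h
  rw [← mul_assoc]
  exact natLe_right b (natLe_of_mul_idem hM c he)

theorem natLe_inv (hM : IsInverseMonoid inv) {a b : M} (h : natLe a b) :
    natLe (inv a) (inv b) := by
  obtain ⟨e, he, rfl⟩ := h
  rw [inv_mul' hM, inv_idem hM he]
  exact natLe_of_mul_idem hM _ he

theorem natLe_one {e : M} (he : e * e = e) : natLe e 1 := ⟨e, he, by simp⟩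

theorem max_one : IsMaximal (1 : M) := by
  rintro n ⟨e, he, h⟩
  have : e = 1 := by
    calc e = e * 1 := by simp
      _ = (e * e) * n := by rw [mul_assoc, ← h]
      _ = 1 := by rw [he, ← h]
  rw [this] at h; simpa using h.symm

theorem natLe_antisymm (hM : IsInverseMonoid inv) {a b : M} (h1 : natLe a b) (h2 : natLe b a) :
    a = b := by
  obtain ⟨e, he, ha⟩ := h1
  obtain ⟨f, hf, hb⟩ := h2
  have h3 : e * a = a := by conv_lhs => rw [ha]
                            rw [← mul_assoc, he, ← ha]
  calc a = e * b := ha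
    _ = f * (e * a) := by rw [hb, ← mul_assoc, idem_comm hM he hf, mul_assoc]
    _ = b := by rw [h3, ← hb]

theorem max_inv (hM : IsInverseMonoid inv) {a : M} (h : IsMaximal a) : IsMaximal (inv a) := by
  intro n hn
  have := natLe_inv hM hn
  rw [inv_inv' hM] at this
  rw [← h _ this, inv_inv' hM]

theorem exists_max (hM : IsInverseMonoid inv) (hfa : FiniteAbove M) (m : M) :
    ∃ n, natLe m n ∧ IsMaximal n := by
  let P : PartialOrder M :=
    { le := natLe
      le_refl := natLe_refl
      le_trans := fun _ _ _ => natLe_trans hM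
      le_antisymm := fun _ _ => natLe_antisymm hM }
  obtain ⟨n, hn⟩ := (hfa m).exists_maximal ⟨m, natLe_refl m⟩
  refine ⟨n, hn.1, fun k hk => ?_⟩
  exact natLe_antisymm hM (hn.2 (natLe_trans hM hn.1 hk) hk) hk

theorem partTwo (hM : IsInverseMonoid inv) (hfa : FiniteAbove M)
    (hu : ∀ m₁ m₂ : M, IsMaximal m₁ → IsMaximal m₂ → sigmaRel m₁ m₂ → m₁ = m₂) :
    ∃ instH : Group {m : M // IsMaximal m}, @AbelianKernelCover M _ inv _ instH := by
  choose top htop hmax using exists_max hM hfa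
  have huniq : ∀ {x n : M}, natLe x n → IsMaximal n → top x = n := fun {x n} h hn =>
    hu _ _ (hmax x) hn ⟨x, htop x, h⟩
  have hle : ∀ {x y : M}, natLe x y → top x = top y := fun {x y} h =>
    huniq (natLe_trans hM h (htop y)) (hmax y)
  let G : Group {m : M // IsMaximal m} :=
    { mul := fun a b => ⟨top (a.1 * b.1), hmax _⟩
      one := ⟨1, max_one⟩
      inv := fun a => ⟨inv a.1, max_inv hM a.2⟩
      mul_assoc := fun a b c => Subtype.ext (by
        change top (top (a.1 * b.1) * c.1) = top (a.1 * top (b.1 * c.1))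
        rw [← hle (natLe_right c.1 (htop (a.1 * b.1))), ← hle (natLe_left hM a.1 (htop (b.1 * c.1))),
          mul_assoc])
      one_mul := fun a => Subtype.ext (huniq (by
        change natLe (1 * a.1) a.1
        rw [one_mul]; exact natLe_refl _) a.2)
      mul_one := fun a => Subtype.ext (huniq (by
        change natLe (a.1 * 1) a.1
        rw [mul_one]; exact natLe_refl _) a.2)
      inv_mul_cancel := fun a => Subtype.ext (huniq (natLe_one (idem_l hM a.1)) max_one) }
  refine ⟨G, fun a => a.1, ⟨rfl, fun _ => rfl, fun g h => htop _⟩,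
    fun m => ⟨⟨top m, hmax m⟩, htop m⟩, ?_⟩
  intro k₁ k₂ h1 h2
  have e1 : k₁ = k₂ := Subtype.ext ((k₁.2 _ (natLe_one h1)).symm.trans (k₂.2 _ (natLe_one h2)))
  rw [e1]

end Basic

section Grp
open Classical in
/-- twisted action on finsets -/
noncomputable def tw {I : Type*} (s : I → I) (u v : Finset I) : Finset I :=
  if Even u.card then v else v.image s

open Classical in
theorem even_symmDiff {I : Type*} (u v : Finset I) :
    Even (symmDiff u v).card ↔ (Even u.card ↔ Even v.card) := by
  have h1 : (symmDiff u v).card = (u \ v).card + (v \ u).card := by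
    rw [symmDiff_def, Finset.sup_eq_union, Finset.card_union_of_disjoint disjoint_sdiff_sdiff]
  have h2 := Finset.card_sdiff_add_card_inter u v
  have h3 := Finset.card_sdiff_add_card_inter v u
  rw [Finset.inter_comm] at h3
  rw [h1, ← h2, ← h3]
  simp only [Nat.even_add]; tauto

open Classical in
theorem tw_even {I : Type*} {s : I → I} (hs : Function.Involutive s) (u v : Finset I) :
    Even (tw s u v).card ↔ Even v.card := by
  unfold tw; split_ifs
  · rfl
  · rw [Finset.card_image_of_injective _ hs.injective]

open Classical in
theorem image_image_inv {I : Type*} {s : I → I} (hs : Function.Involutive s) (v : Finset I) :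
    (v.image s).image s = v := by
  rw [Finset.image_image, hs.comp_self, Finset.image_id]

open Classical in
/-- the group of finsets with twisted symmetric difference -/
@[reducible] noncomputable def finGroup {I : Type*} (s : I → I) (hs : Function.Involutive s) :
    Group (Finset I) where
  mul u v := symmDiff u (tw s u v)
  one := ∅
  inv u := tw s u u
  mul_assoc u v w := by
    change symmDiff (symmDiff u (tw s u v)) (tw s (symmDiff u (tw s u v)) w) =
      symmDiff u (tw s u (symmDiff v (tw s v w)))
    rw [symmDiff_assoc]
    congr 1
    have hE := even_symmDiff u (tw s u v)
    rw [tw_even hs] at hE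
    by_cases hu : Even u.card <;> by_cases hv : Even v.card <;>
      simp [tw, hu, hv, Finset.image_symmDiff _ _ hs.injective, image_image_inv hs] <;>
      simp [tw, hu, hv] at hE <;> simp [hE]
  one_mul u := by
    change symmDiff ∅ (tw s ∅ u) = u
    have : tw s ∅ u = u := by simp [tw]
    rw [this, ← Finset.bot_eq_empty, bot_symmDiff]
  mul_one u := by
    change symmDiff u (tw s u ∅) = u
    have : tw s u ∅ = ∅ := by simp [tw]
    rw [this, ← Finset.bot_eq_empty, symmDiff_bot]
  inv_mul_cancel u := by
    change symmDiff (tw s u u) (tw s (tw s u u) u) = ∅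
    have h : tw s (tw s u u) u = tw s u u := by
      have := tw_even hs u u
      change (if Even (tw s u u).card then u else u.image s) =
        if Even u.card then u else u.image s
      by_cases hu : Even u.card
      · rw [if_pos (this.2 hu), if_pos hu]
      · rw [if_neg (fun h => hu (this.1 h)), if_neg hu]
    rw [h, symmDiff_self]; rfl
end Grp

section PartOne
variable {M : Type*} [Monoid M] {inv : M → M}

theorem inv_not_idem (hM : IsInverseMonoid inv) {m : M} (h : ¬ m * m = m) :
    ¬ inv m * inv m = inv m := fun h' => h (by
  have := inv_idem hM h'
  rw [inv_inv' hM] at this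
  rw [← this] at h'
  exact h')

/-- The non-idempotent elements. -/
@[ext] structure NI (M : Type*) [Monoid M] where
  val : M
  property : ¬ val * val = val

open Classical in
theorem partOne (hM : IsInverseMonoid inv) (hEU : EUnitary M)
    (hA : ∀ x y : M, ¬ x * x = x → ¬ y * y = y → (x * y) * (x * y) = x * y) :
    ∃ instH : Group (Finset (NI M)), @AbelianKernelCover M _ inv _ instH := by
  let s : NI M → NI M := fun m => ⟨inv m.1, inv_not_idem hM m.2⟩
  have hs : Function.Involutive s := fun m => NI.ext (inv_inv' hM m.1)
  have hii := inv_inv' hM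
  -- swapping products of non-idempotents
  have hsw : ∀ x y : NI M, x.1 * y.1 = inv y.1 * inv x.1 := fun x y => by
    rw [← inv_mul' hM, inv_idem hM (hA x.1 y.1 x.2 y.2)]
  have hconj : ∀ x m : NI M, x.1 * (m.1 * inv m.1) = (inv m.1 * m.1) * x.1 := fun x m => by
    calc x.1 * (m.1 * inv m.1) = (x.1 * m.1) * inv m.1 := by rw [mul_assoc]
      _ = inv m.1 * (inv x.1 * inv m.1) := by rw [hsw x m, mul_assoc]
      _ = (inv m.1 * m.1) * x.1 := by rw [← hsw m x, mul_assoc]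
  have hcomp : ∀ x m : NI M, x.1 * inv x.1 * m.1 = m.1 * inv m.1 * x.1 := fun x m => by
    have a1 : inv x.1 * m.1 = inv m.1 * x.1 := by
      have := hsw (s x) m
      simpa only [s, hii] using this
    have a2 : (inv m.1 * x.1) * (inv m.1 * x.1) = inv m.1 * x.1 :=
      hA (s m).1 x.1 (s m).2 x.2
    calc x.1 * inv x.1 * m.1 = x.1 * inv x.1 * (m.1 * inv m.1 * m.1) := by rw [hM.1]
      _ = (x.1 * inv x.1) * (m.1 * inv m.1) * m.1 := by simp only [mul_assoc]
      _ = (m.1 * inv m.1) * (x.1 * inv x.1) * m.1 := by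
          rw [idem_comm hM (idem_r hM x.1) (idem_r hM m.1)]
      _ = m.1 * (inv m.1 * x.1) * (inv x.1 * m.1) := by simp only [mul_assoc]
      _ = m.1 * inv m.1 * x.1 := by rw [a1, mul_assoc, a2, mul_assoc]
  have hprod : ∀ x y : NI M, x.1 * y.1 = (x.1 * inv x.1) * (inv y.1 * y.1) := fun x y => by
    have h := hcomp x (s y)
    simp only [s, hii] at h
    calc x.1 * y.1 = inv y.1 * inv x.1 := hsw x y
      _ = inv y.1 * y.1 * inv y.1 * inv x.1 := by rw [hM.2.1]
      _ = inv y.1 * y.1 * (x.1 * y.1) := by rw [hsw x y, mul_assoc]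
      _ = (x.1 * inv x.1 * inv y.1) * y.1 := by rw [h, mul_assoc (inv y.1 * y.1)]
      _ = _ := by simp only [mul_assoc]
  let E := {e : M // e * e = e}
  let _ : CommMonoid E :=
    { mul := fun a b => ⟨a.1 * b.1, idem_mul hM a.2 b.2⟩
      one := ⟨1, by simp⟩
      mul_assoc := fun a b c => Subtype.ext (mul_assoc _ _ _)
      one_mul := fun a => Subtype.ext (one_mul _)
      mul_one := fun a => Subtype.ext (mul_one _)
      mul_comm := fun a b => Subtype.ext (idem_comm hM a.2 b.2) }
  have hEid : ∀ a : E, a * a = a := fun a => Subtype.ext a.2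
  let d : NI M → E := fun m => ⟨m.1 * inv m.1, idem_r hM m.1⟩
  let p : Finset (NI M) → E := fun v => ∏ i ∈ v, d i
  have pins : ∀ (a : NI M) (v : Finset (NI M)), p (insert a v) = d a * p v := fun a v => by
    by_cases h : a ∈ v
    · rw [Finset.insert_eq_of_mem h]
      change ∏ i ∈ v, d i = d a * ∏ i ∈ v, d i
      rw [← Finset.mul_prod_erase v d h, ← mul_assoc, hEid]
    · exact Finset.prod_insert h
  have pun : ∀ u v : Finset (NI M), p (u ∪ v) = p u * p v := fun u v => by
    induction u using Finset.induction_on with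
    | empty => simp [p]
    | insert a u ha ih => rw [Finset.insert_union, pins, pins, ih, mul_assoc]
  have psub : ∀ {u v : Finset (NI M)}, u ⊆ v → p v * p u = p v := fun {u v} h => by
    rw [← pun, Finset.union_eq_left.2 h]
  have psing : ∀ a : NI M, p {a} = d a := fun a => Finset.prod_singleton _ _
  have pval : ∀ a b : E, (a * b).1 = a.1 * b.1 := fun _ _ => rfl
  -- well-definedness
  have hwd : ∀ {w : Finset (NI M)} {m n : NI M}, m ∈ w → n ∈ w → (p w).1 * m.1 = (p w).1 * n.1 := by
    intro w m n hm hn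
    have h1 := psub (Finset.singleton_subset_iff.2 hm)
    have h2 := psub (Finset.singleton_subset_iff.2 hn)
    rw [psing] at h1 h2
    calc (p w).1 * m.1 = (p w * d n).1 * m.1 := by rw [h2]
      _ = (p w).1 * (n.1 * inv n.1 * m.1) := by rw [pval, mul_assoc]
      _ = (p w).1 * (d m).1 * n.1 := by rw [hcomp, mul_assoc (p w).1]
      _ = (p w * d m).1 * n.1 := by rw [pval]
      _ = _ := by rw [h1]
  have hcom : ∀ (x : NI M) (v : Finset (NI M)), x.1 * (p v).1 = (p (v.image s)).1 * x.1 := fun x v => by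
    induction v using Finset.induction_on with
    | empty =>
      change x.1 * 1 = 1 * x.1
      simp
    | insert a v ha ih =>
      have hd : x.1 * (d a).1 = (d (s a)).1 * x.1 := by
        change x.1 * (a.1 * inv a.1) = inv a.1 * inv (inv a.1) * x.1
        rw [hii, hconj]
      rw [Finset.image_insert, pins, pins, pval, pval, ← mul_assoc, hd, mul_assoc, ih,
        mul_assoc (d (s a)).1]
  let ψ : Finset (NI M) → M := fun v =>
    if Even v.card then (p v).1 else if h : v.Nonempty then (p v).1 * (h.choose).1 else 1
  have ψe : ∀ {v : Finset (NI M)}, Even v.card → ψ v = (p v).1 := fun {v} h => by simp [ψ, h]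
  have ne : ∀ {v : Finset (NI M)}, ¬ Even v.card → ∃ m, m ∈ v := fun {v} h => by
    by_contra h'
    push Not at h'
    exact h (by rw [Finset.eq_empty_of_forall_notMem h']; simp)
  have ψo : ∀ {v : Finset (NI M)} {m : NI M}, ¬ Even v.card → m ∈ v → ψ v = (p v).1 * m.1 :=
    fun {v m} h hm => by
      have hne : v.Nonempty := ⟨m, hm⟩
      simp only [ψ, h, hne, if_false, dif_pos]
      exact hwd hne.choose_spec hm
  have sdsub : ∀ u v : Finset (NI M), symmDiff u v ⊆ u ∪ v := fun u v => by
    intro x hx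
    rw [Finset.mem_symmDiff] at hx
    rw [Finset.mem_union]; tauto
  have key : ∀ (u v : Finset (NI M)) (n : NI M), ¬ Even (symmDiff u v).card → n ∈ u ∪ v →
      natLe ((p u).1 * (p v).1 * n.1) (ψ (symmDiff u v)) := fun u v n h hn => by
    obtain ⟨k, hk⟩ := ne h
    rw [ψo h hk]
    refine ⟨(p (u ∪ v)).1, (p (u ∪ v)).2, ?_⟩
    rw [← mul_assoc, ← pval, ← pval, ← pun, psub (sdsub u v)]
    exact hwd hn (sdsub _ _ hk)
  have key2 : ∀ (u v : Finset (NI M)), Even (symmDiff u v).card →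
      natLe ((p u).1 * (p v).1) (ψ (symmDiff u v)) := fun u v h => by
    rw [ψe h]
    refine ⟨(p (u ∪ v)).1, (p (u ∪ v)).2, ?_⟩
    rw [← pval, ← pval, ← pun, psub (sdsub u v)]
  have himg : ∀ v : Finset (NI M), (v.image s).card = v.card := fun v =>
    Finset.card_image_of_injective _ hs.injective
  refine ⟨finGroup s hs, ψ, ⟨?_, ?_, ?_⟩, ?_, ?_⟩
  · exact ψe (v := ∅) (by simp)
  · intro u
    change ψ (tw s u u) = inv (ψ u)
    by_cases hu : Even u.card
    · rw [tw, if_pos hu, ψe hu, inv_idem hM (p u).2]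
    · obtain ⟨m, hm⟩ := ne hu
      rw [tw, if_neg hu, ψo hu hm, ψo (m := s m) (by rwa [himg]) (Finset.mem_image_of_mem s hm),
        inv_mul' hM, inv_idem hM (p u).2]
      exact (hcom (s m) u).symm
  · intro u v
    change natLe (ψ u * ψ v) (ψ (symmDiff u (tw s u v)))
    have hE := even_symmDiff u (tw s u v)
    rw [tw_even hs] at hE
    by_cases hu : Even u.card
    · rw [tw, if_pos hu] at hE ⊢
      by_cases hv : Even v.card
      · rw [ψe hu, ψe hv]
        exact key2 u v (by tauto)
      · obtain ⟨n, hn⟩ := ne hv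
        rw [ψe hu, ψo hv hn, ← mul_assoc]
        exact key u v n (by tauto) (Finset.mem_union_right _ hn)
    · rw [tw, if_neg hu] at hE ⊢
      obtain ⟨m, hm⟩ := ne hu
      by_cases hv : Even v.card
      · rw [ψo hu hm, ψe hv, mul_assoc, hcom, ← mul_assoc]
        exact key u _ m (by tauto) (Finset.mem_union_left _ hm)
      · obtain ⟨n, hn⟩ := ne hv
        have h1 := psub (Finset.singleton_subset_iff.2 hm)
        have h2 := psub (Finset.singleton_subset_iff.2 (Finset.mem_image_of_mem s hn))
        rw [psing] at h1 h2
        have hds : (d (s n)).1 = inv n.1 * n.1 := by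
          change inv n.1 * inv (inv n.1) = _
          rw [hii]
        have : ψ u * ψ v = (p u).1 * (p (v.image s)).1 := by
          calc ψ u * ψ v = (p u).1 * (m.1 * (p v).1) * n.1 := by
                rw [ψo hu hm, ψo hv hn]; simp only [mul_assoc]
            _ = (p u).1 * (p (v.image s)).1 * (m.1 * n.1) := by
                rw [hcom]; simp only [mul_assoc]
            _ = (p u * p (v.image s) * (d m * d (s n))).1 := by
                rw [hprod, pval, pval, pval, hds]
            _ = ((p u * d m) * (p (v.image s) * d (s n))).1 := by
                rw [mul_mul_mul_comm]
            _ = _ := by rw [h1, h2, pval]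
        rw [this]
        exact key2 u _ (by tauto)
  · intro m
    by_cases hm : m * m = m
    · refine ⟨∅, ?_⟩
      have : ψ ∅ = 1 := ψe (v := ∅) (by simp)
      rw [this]; exact natLe_one hm
    · refine ⟨{⟨m, hm⟩}, ?_⟩
      rw [ψo (m := ⟨m, hm⟩) (by simp) (by simp), psing]
      change natLe m (m * inv m * m)
      rw [hM.1]; exact natLe_refl m
  · intro u v hu hv
    have hev : ∀ {w : Finset (NI M)}, ψ w * ψ w = ψ w → Even w.card := fun {w} h => by
      by_contra h'
      obtain ⟨m, hm⟩ := ne h'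
      exact m.2 (hEU _ m.1 h ⟨(p w).1, (p w).2, ψo h' hm⟩)
    change symmDiff u (tw s u v) = symmDiff v (tw s v u)
    rw [tw, tw, if_pos (hev hu), if_pos (hev hv), symmDiff_comm]

end PartOne
end FInv

/-- If a finite-above E-unitary inverse monoid has no F-inverse cover via Abelian
groups, then `M/σ` has at least two elements distinct from the identity, and some
σ-class contains at least two maximal elements. -/
theorem stmt14 {M : Type u} [Monoid M] (inv : M → M)
    (hM : IsInverseMonoid inv) (hfa : FiniteAbove M) (hEU : EUnitary M)
    (hno : ¬ ∃ (H : Type u) (instH : Group H), @AbelianKernelCover M _ inv H instH) :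
    (∃ x y : M, ¬ sigmaRel x y ∧ ¬ sigmaRel x 1 ∧ ¬ sigmaRel y 1) ∧
    (∃ m₁ m₂ : M, m₁ ≠ m₂ ∧ IsMaximal m₁ ∧ IsMaximal m₂ ∧ sigmaRel m₁ m₂) := by
  constructor
  · by_contra hcon
    apply hno
    refine ⟨_, partOne hM hEU ?_⟩
    intro x y hx hy
    have hy' := inv_not_idem hM hy
    have h1 : ∀ z : M, ¬ z * z = z → ¬ sigmaRel z 1 := by
      rintro z hz ⟨c, hcz, ⟨e, he, hce⟩⟩
      rw [mul_one] at hce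
      subst hce
      exact hz (hEU _ _ he hcz)
    have h2 : sigmaRel x (inv y) := by
      by_contra h
      exact hcon ⟨x, inv y, h, h1 x hx, h1 _ hy'⟩
    obtain ⟨c, hcx, hcy⟩ := h2
    have h3 : natLe (c * y) (x * y) := natLe_right y hcx
    obtain ⟨f, hf, hc⟩ := hcy
    have h4 : (c * y) * (c * y) = c * y := by
      rw [hc, mul_assoc f]
      exact idem_mul hM hf (idem_l hM y)
    exact hEU _ _ h4 h3
  · by_contra hcon
    apply hno
    refine ⟨_, partTwo hM hfa ?_⟩
    intro m₁ m₂ h1 h2 h3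
    by_contra hne
    exact hcon ⟨m₁, m₂, hne, h1, h2, h3⟩
end

section
/- Let M be a finite-above inverse monoid in which any two σ-related maximal elements are equal (every σ-class contains at most one maximal element of M). Then M is F-inverse: every σ-class contains a greatest element with respect to the natural partial order. -/
open FInv

theorem aux_idem {M : Type*} [Monoid M] (inv : M → M) (hM : IsInverseMonoid inv)
    (e f : M) (he : e * e = e) (hf : f * f = f) : (e * f) * (e * f) = e * f := by
  obtain ⟨h1, h2, h3⟩ := hM
  have he' : ∀ z, e * (e * z) = e * z := fun z => by rw [← mul_assoc, he]
  have hf' : ∀ z, f * (f * z) = f * z := fun z => by rw [← mul_assoc, hf]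
  have k1 := h1 (e * f)
  have k2 := h2 (e * f)
  have k3 := h3 (e * f)
  generalize inv (e * f) = x at k1 k2 k3
  have hx : f * x * e = x := by
    apply k3
    · simp only [mul_assoc, he', hf'] at k1 ⊢
      exact k1
    · have : f * x * e * (e * f) * (f * x * e) = f * (x * (e * f) * x) * e := by
        simp only [mul_assoc, he', hf']
      rw [this, k2]
  have hxx : x * x = x := by
    calc x * x = (f * x * e) * (f * x * e) := by rw [hx]
      _ = f * (x * (e * f) * x) * e := by simp only [mul_assoc]
      _ = x := by rw [k2, hx]
  have a1 : x = inv x := h3 x x (by rw [hxx, hxx]) (by rw [hxx, hxx])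
  have a2 : e * f = inv x := h3 x (e * f) k2 k1
  rw [a2, ← a1, hxx]

theorem aux_comm {M : Type*} [Monoid M] (inv : M → M) (hM : IsInverseMonoid inv)
    (e f : M) (he : e * e = e) (hf : f * f = f) : e * f = f * e := by
  have i1 := aux_idem inv hM e f he hf
  have i2 := aux_idem inv hM f e hf he
  obtain ⟨h1, h2, h3⟩ := hM
  have he' : ∀ z, e * (e * z) = e * z := fun z => by rw [← mul_assoc, he]
  have hf' : ∀ z, f * (f * z) = f * z := fun z => by rw [← mul_assoc, hf]
  have a1 : e * f = inv (e * f) := h3 _ _ (by rw [i1, i1]) (by rw [i1, i1])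
  have a2 : f * e = inv (e * f) := by
    apply h3
    · simp only [mul_assoc, he', hf'] at i1 ⊢
      exact i1
    · simp only [mul_assoc, he', hf'] at i2 ⊢
      exact i2
  rw [a2, ← a1]

theorem aux_trans {M : Type*} [Monoid M] (inv : M → M) (hM : IsInverseMonoid inv)
    (a b c : M) (hab : natLe a b) (hbc : natLe b c) : natLe a c := by
  obtain ⟨e, he, rfl⟩ := hab
  obtain ⟨f, hf, rfl⟩ := hbc
  exact ⟨e * f, aux_idem inv hM e f he hf, (mul_assoc _ _ _).symm⟩

theorem aux_antisymm {M : Type*} [Monoid M] (inv : M → M) (hM : IsInverseMonoid inv)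
    (a b : M) (hab : natLe a b) (hba : natLe b a) : a = b := by
  obtain ⟨e, he, h1⟩ := hab
  obtain ⟨f, hf, h2⟩ := hba
  have hea : e * a = a := by rw [h1, ← mul_assoc, he]
  calc a = e * b := h1
    _ = e * (f * a) := by rw [← h2]
    _ = f * (e * a) := by rw [← mul_assoc, aux_comm inv hM e f he hf, mul_assoc]
    _ = b := by rw [hea, ← h2]

theorem aux_max {M : Type*} [Monoid M] (inv : M → M) (hM : IsInverseMonoid inv)
    (hfa : FiniteAbove M) (x : M) : ∃ m, natLe x m ∧ IsMaximal m := by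
  letI : PartialOrder M :=
    { le := natLe
      le_refl := fun a => ⟨1, one_mul 1, (one_mul a).symm⟩
      le_trans := aux_trans inv hM
      le_antisymm := aux_antisymm inv hM }
  obtain ⟨m, hm, hmax⟩ := (hfa x).exists_le_maximal (a := x) (le_refl x)
  refine ⟨m, hm, fun n hn => ?_⟩
  exact le_antisymm (hmax.2 (le_trans (α := M) hm hn) hn) hn

/-- A finite-above inverse monoid in which every σ-class contains at most one
maximal element is F-inverse. -/
theorem stmt15 {M : Type*} [Monoid M] (inv : M → M)
    (hM : IsInverseMonoid inv) (hfa : FiniteAbove M)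
    (huniq : ∀ m₁ m₂ : M, IsMaximal m₁ → IsMaximal m₂ → sigmaRel m₁ m₂ → m₁ = m₂) :
    ∀ x : M, ∃ m : M, sigmaRel x m ∧ ∀ y : M, sigmaRel x y → natLe y m := by
  intro x
  obtain ⟨m, hxm, hm⟩ := aux_max inv hM hfa x
  refine ⟨m, ⟨x, ⟨1, one_mul 1, (one_mul x).symm⟩, hxm⟩, ?_⟩
  rintro y ⟨c, hcx, hcy⟩
  obtain ⟨m', hym, hm'⟩ := aux_max inv hM hfa y
  rw [huniq m m' hm hm' ⟨c, aux_trans inv hM _ _ _ hcx hxm, aux_trans inv hM _ _ _ hcy hym⟩]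
  exact hym
end
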